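/- arXiv:1505.04769 — 2 statements merged into one kernel-verified Lean document; each statement's English description precedes it below -/
import Mathlib

section
/- The group of rational points of the elliptic curve E₁ : y² + xy + y = x³ + x² − 10x − 10 over ℚ (Cremona label 15A1) is isomorphic to ℤ/2ℤ ⊕ ℤ/4ℤ. -/
/-- `E₁ : y² + xy + y = x³ + x² − 10x − 10`, the elliptic curve of Cremona label 15A1,
viewed as a Weierstrass curve over `ℚ` in affine coordinates. -/
def E₁ : WeierstrassCurve.Affine ℚ :=
  { a₁ := 1, a₂ := 1, a₃ := 1, a₄ := -10, a₆ := -10 }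

/-- Coprime solutions of `a² = e² + b² = 81 e² + c²` with `e > 0`. -/
def Conc (a e : ℤ) : Prop :=
  0 < e ∧ IsCoprime a e ∧ (∃ b : ℤ, a ^ 2 = e ^ 2 + b ^ 2) ∧ ∃ c : ℤ, a ^ 2 = 81 * e ^ 2 + c ^ 2

theorem conc_of_pos {g b x y : ℤ} (hb : 0 < b) (h : IsCoprime g b)
    (h1 : g ^ 2 - b ^ 2 = x ^ 2) (h2 : g ^ 2 - 81 * b ^ 2 = y ^ 2) : Conc g b :=
  ⟨hb, h, ⟨x, by linarith⟩, ⟨y, by linarith⟩⟩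

theorem three_dvd_of_sq_add {x y : ℤ} (h : (3 : ℤ) ∣ x ^ 2 + y ^ 2) : (3 : ℤ) ∣ x ∧ (3 : ℤ) ∣ y := by
  have hx : x % 3 = 0 ∨ x % 3 = 1 ∨ x % 3 = 2 := by omega
  have hy : y % 3 = 0 ∨ y % 3 = 1 ∨ y % 3 = 2 := by omega
  have h' : (x ^ 2 + y ^ 2) % 3 = 0 := Int.emod_eq_zero_of_dvd h
  rcases hx with hx | hx | hx <;> rcases hy with hy | hy | hy <;>
    simp [pow_two, Int.add_emod, Int.mul_emod, hx, hy] at h' <;> omega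

theorem conc_of_neg {g b x y : ℤ} (hg : 0 < g) (h : IsCoprime g b)
    (h1 : b ^ 2 - g ^ 2 = x ^ 2) (h2 : 81 * b ^ 2 - g ^ 2 = y ^ 2) :
    ∃ a e, Conc a e ∧ e ≤ g := by
  obtain ⟨⟨g1, hg1⟩, ⟨y1, hy1⟩⟩ : (3 : ℤ) ∣ g ∧ (3 : ℤ) ∣ y :=
    three_dvd_of_sq_add ⟨27 * b ^ 2, by linarith⟩
  subst hg1 hy1
  obtain ⟨⟨g2, hg2⟩, ⟨y2, hy2⟩⟩ : (3 : ℤ) ∣ g1 ∧ (3 : ℤ) ∣ y1 :=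
    three_dvd_of_sq_add ⟨3 * b ^ 2, by linarith⟩
  subst hg2 hy2
  refine ⟨b, g2, ⟨by omega, ?_, ⟨y2, by linarith⟩, ⟨x, by linarith⟩⟩, by omega⟩
  have : IsCoprime (9 * g2) b := by convert h using 1; ring
  exact (IsCoprime.of_mul_left_right this).symm

/-- positive `k = j²` or negative `k = - j²` -/
theorem conc_of_unit {g b x y k : ℤ} (hg : 0 < g) (hb : 0 < b) (h : IsCoprime g b)
    (h1 : g ^ 2 - b ^ 2 = k * x ^ 2) (h2 : g ^ 2 - 81 * b ^ 2 = k * y ^ 2)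
    (hk : k = 1 ∨ k = 16 ∨ k = -1 ∨ k = -16) : ∃ a e, Conc a e ∧ (e ≤ g ∨ e ≤ b) := by
  rcases hk with rfl | rfl | rfl | rfl
  · exact ⟨g, b, conc_of_pos hb h (x := x) (y := y) (by linarith) (by linarith), Or.inr le_rfl⟩
  · exact ⟨g, b, conc_of_pos hb h (x := 4 * x) (y := 4 * y) (by linarith) (by linarith),
      Or.inr le_rfl⟩
  · obtain ⟨a, e, h3, h4⟩ := conc_of_neg hg h (x := x) (y := y) (by linarith) (by linarith)
    exact ⟨a, e, h3, Or.inl h4⟩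
  · obtain ⟨a, e, h3, h4⟩ := conc_of_neg hg h (x := 4 * x) (y := 4 * y) (by linarith) (by linarith)
    exact ⟨a, e, h3, Or.inl h4⟩

theorem odd_sq_mod {x : ℤ} (h : x % 2 = 1) : x ^ 2 % 8 = 1 := by
  have : x % 8 = 1 ∨ x % 8 = 3 ∨ x % 8 = 5 ∨ x % 8 = 7 := by omega
  rcases this with h | h | h | h <;> simp [pow_two, Int.mul_emod, h]

theorem even_sq_mod {x : ℤ} (h : x % 2 = 0) : x ^ 2 % 8 = 0 ∨ x ^ 2 % 8 = 4 := by
  have : x % 8 = 0 ∨ x % 8 = 2 ∨ x % 8 = 4 ∨ x % 8 = 6 := by omega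
  rcases this with h | h | h | h <;> simp [pow_two, Int.mul_emod, h]

theorem not_both_even {x y : ℤ} (h : IsCoprime x y) : x % 2 = 1 ∨ y % 2 = 1 := by
  by_contra hc
  have h1 : (2 : ℤ) ∣ x := by omega
  have h2 : (2 : ℤ) ∣ y := by omega
  have := h.isUnit_of_dvd' h1 h2
  rw [Int.isUnit_iff] at this
  omega

theorem no_even {g b x y k : ℤ} (h : IsCoprime g b) (h' : IsCoprime x y)
    (h1 : g ^ 2 - b ^ 2 = k * x ^ 2) (h2 : g ^ 2 - 81 * b ^ 2 = k * y ^ 2)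
    (hk : k = 2 ∨ k = 4 ∨ k = 8 ∨ k = 10 ∨ k = 20 ∨ k = 40 ∨
      k = -2 ∨ k = -4 ∨ k = -8 ∨ k = -10 ∨ k = -20 ∨ k = -40) : False := by
  have e1 := not_both_even h
  have e2 := not_both_even h'
  have g1 : g % 2 = 0 ∨ g % 2 = 1 := by omega
  have b1 : b % 2 = 0 ∨ b % 2 = 1 := by omega
  have x1 : x % 2 = 0 ∨ x % 2 = 1 := by omega
  have y1 : y % 2 = 0 ∨ y % 2 = 1 := by omega
  have g2 : (g % 2 = 0 ∧ (g ^ 2 % 8 = 0 ∨ g ^ 2 % 8 = 4)) ∨ (g % 2 = 1 ∧ g ^ 2 % 8 = 1) :=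
    g1.imp (fun h => ⟨h, even_sq_mod h⟩) (fun h => ⟨h, odd_sq_mod h⟩)
  have b2 : (b % 2 = 0 ∧ (b ^ 2 % 8 = 0 ∨ b ^ 2 % 8 = 4)) ∨ (b % 2 = 1 ∧ b ^ 2 % 8 = 1) :=
    b1.imp (fun h => ⟨h, even_sq_mod h⟩) (fun h => ⟨h, odd_sq_mod h⟩)
  have x2 : (x % 2 = 0 ∧ (x ^ 2 % 8 = 0 ∨ x ^ 2 % 8 = 4)) ∨ (x % 2 = 1 ∧ x ^ 2 % 8 = 1) :=
    x1.imp (fun h => ⟨h, even_sq_mod h⟩) (fun h => ⟨h, odd_sq_mod h⟩)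
  have y2 : (y % 2 = 0 ∧ (y ^ 2 % 8 = 0 ∨ y ^ 2 % 8 = 4)) ∨ (y % 2 = 1 ∧ y ^ 2 % 8 = 1) :=
    y1.imp (fun h => ⟨h, even_sq_mod h⟩) (fun h => ⟨h, odd_sq_mod h⟩)
  clear h h' g1 b1 x1 y1
  generalize g ^ 2 = G at *
  generalize b ^ 2 = B at *
  generalize x ^ 2 = X at *
  generalize y ^ 2 = Y at *
  rcases hk with rfl | rfl | rfl | rfl | rfl | rfl | rfl | rfl | rfl | rfl | rfl | rfl <;> omega

theorem conc_of_any {g b x y k : ℤ} (hg : 0 < g) (hb : 0 < b) (hx : 0 < x) (hy : 0 < y)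
    (h : IsCoprime g b) (h' : IsCoprime x y)
    (h1 : g ^ 2 - b ^ 2 = k * x ^ 2) (h2 : g ^ 2 - 81 * b ^ 2 = k * y ^ 2) :
    ∃ a e, Conc a e ∧ (e ≤ g ∨ e ≤ b ∨ e ≤ x ∨ e ≤ y) := by
  have hk : k ∣ 80 := by
    have d1 : k ∣ 80 * b ^ 2 := ⟨x ^ 2 - y ^ 2, by linarith⟩
    have d2 : k ∣ 80 * g ^ 2 := ⟨81 * x ^ 2 - y ^ 2, by linarith⟩
    obtain ⟨u, v, huv⟩ := h.pow (m := 2) (n := 2)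
    have : (80 : ℤ) = u * (80 * g ^ 2) + v * (80 * b ^ 2) := by linear_combination (-80) * huv
    rw [this]
    exact dvd_add (d2.mul_left u) (d1.mul_left v)
  have hcases : (k = 1 ∨ k = 16 ∨ k = -1 ∨ k = -16) ∨ (k = 5 ∨ k = 80 ∨ k = -5 ∨ k = -80) ∨
      (k = 2 ∨ k = 4 ∨ k = 8 ∨ k = 10 ∨ k = 20 ∨ k = 40 ∨
      k = -2 ∨ k = -4 ∨ k = -8 ∨ k = -10 ∨ k = -20 ∨ k = -40) := by
    have hle := Int.le_of_dvd (by norm_num) hk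
    have hge := Int.le_of_dvd (by norm_num) ((neg_dvd).2 hk)
    obtain ⟨l, hl⟩ := hk
    have : -80 ≤ k := by omega
    interval_cases k <;> omega
  rcases hcases with hk | hk | hk
  · obtain ⟨a, e, h3, h4⟩ := conc_of_unit hg hb h h1 h2 hk
    exact ⟨a, e, h3, by tauto⟩
  · have key : ∃ l : ℤ, y ^ 2 - x ^ 2 = l * b ^ 2 ∧ y ^ 2 - 81 * x ^ 2 = l * g ^ 2 ∧
        (l = 1 ∨ l = 16 ∨ l = -1 ∨ l = -16) := by
      rcases hk with rfl | rfl | rfl | rfl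
      · exact ⟨-16, by linarith, by linarith, by simp⟩
      · exact ⟨-1, by linarith, by linarith, by simp⟩
      · exact ⟨16, by linarith, by linarith, by simp⟩
      · exact ⟨1, by linarith, by linarith, by simp⟩
    obtain ⟨l, e1, e2, hl⟩ := key
    obtain ⟨a, e, h3, h4⟩ := conc_of_unit hy hx h'.symm e1 e2 hl
    exact ⟨a, e, h3, by tauto⟩
  · exact (no_even h h' h1 h2 hk).elim

/-- the four-number step -/
theorem four_step {m n t s : ℤ} (hm : 0 < m) (hn : 0 < n) (ht : 0 < t) (hs : 0 < s)
    (hts : IsCoprime t s) (h1 : t * s = m * n) (h2 : m ^ 2 + n ^ 2 = 81 * t ^ 2 + s ^ 2) :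
    ∃ a e, Conc a e ∧ e < 2 * m * n := by
  obtain ⟨b, g, hbg, hb, hg⟩ := Int.exists_gcd_one (m := t) (n := m)
    (by exact_mod_cast Int.gcd_pos_of_ne_zero_left m ht.ne')
  have hα : (0 : ℤ) < (Int.gcd t m : ℤ) := by
    exact_mod_cast Int.gcd_pos_of_ne_zero_left m ht.ne'
  generalize (Int.gcd t m : ℤ) = α at *
  have cbg : IsCoprime b g := Int.isCoprime_iff_gcd_eq_one.2 hbg
  subst hb hg
  have h3 : b * s = g * n := by
    have : α * (b * s) = α * (g * n) := by linarith
    exact mul_left_cancel₀ hα.ne' this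
  obtain ⟨δ, rfl⟩ : g ∣ s := cbg.symm.dvd_of_dvd_mul_left ⟨n, h3⟩
  have hg : 0 < g := by nlinarith
  have hb : 0 < b := by nlinarith
  have hδ : 0 < δ := by nlinarith
  have hn' : n = b * δ := by
    have : g * n = g * (b * δ) := by linarith
    exact mul_left_cancel₀ hg.ne' this
  subst hn'
  have cαδ : IsCoprime α δ :=
    (IsCoprime.of_mul_left_right hts).of_mul_right_right
  have h4 : α ^ 2 * (g ^ 2 - 81 * b ^ 2) = δ ^ 2 * (g ^ 2 - b ^ 2) := by linarith
  obtain ⟨k, hk⟩ : α ^ 2 ∣ g ^ 2 - b ^ 2 :=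
    (cαδ.pow (m := 2) (n := 2)).dvd_of_dvd_mul_left ⟨_, h4.symm⟩
  have h5 : g ^ 2 - 81 * b ^ 2 = k * δ ^ 2 := by
    have : α ^ 2 * (g ^ 2 - 81 * b ^ 2) = α ^ 2 * (k * δ ^ 2) := by rw [h4, hk]; ring
    exact mul_left_cancel₀ (by positivity) this
  obtain ⟨a, e, h6, h7⟩ := conc_of_any hg hb hα hδ cbg.symm cαδ (by linarith) h5
  refine ⟨a, e, h6, ?_⟩
  have p1 : 0 < g * b := by positivity
  have p2 : 0 < α * δ := by positivity
  have q1 : g ≤ g * b := by nlinarith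
  have q2 : b ≤ g * b := by nlinarith
  have q3 : α ≤ α * δ := by nlinarith
  have q4 : δ ≤ α * δ := by nlinarith
  have r1 : g * b ≤ (g * b) * (α * δ) := by nlinarith
  have r2 : α * δ ≤ (g * b) * (α * δ) := by nlinarith
  have : 2 * (g * α) * (b * δ) = 2 * ((g * b) * (α * δ)) := by ring
  rcases h7 with h7 | h7 | h7 | h7 <;> nlinarith

theorem descent {a e : ℤ} (h : Conc a e) : ∃ a' e', Conc a' e' ∧ e' < e := by
  wlog ha : 0 < a generalizing a
  · obtain ⟨he, hc, hb, hc'⟩ := h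
    have ha0 : a ≠ 0 := by
      rintro rfl
      obtain ⟨b, hb⟩ := hb
      nlinarith [sq_nonneg b]
    exact this (a := -a) ⟨he, hc.neg_left, by simpa using hb, by simpa using hc'⟩ (by omega)
  obtain ⟨he, hae, ⟨b, hb⟩, ⟨c, hc⟩⟩ := h
  have cbe : IsCoprime b e := by
    have : IsCoprime (a ^ 2) e := hae.pow_left
    rw [hb] at this
    have h2 : IsCoprime (b ^ 2) e := by
      have heq : b ^ 2 = e ^ 2 + b ^ 2 + e * (-e) := by ring
      rw [heq]
      exact this.add_mul_left_left (-e)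
    exact (IsCoprime.pow_left_iff (by norm_num)).1 h2
  have c3 : ¬ (3 : ℤ) ∣ c := by
    intro h3
    have a3 : (3 : ℤ) ∣ a := by
      apply Int.prime_three.dvd_of_dvd_pow (n := 2)
      rw [hc]
      exact dvd_add (Dvd.intro (27 * e ^ 2) (by ring)) (h3.trans (dvd_pow_self c (by norm_num)))
    have e3 := (three_dvd_of_sq_add (x := e) (y := b)
      (hb ▸ a3.trans (dvd_pow_self a (by norm_num)))).1
    have := hae.isUnit_of_dvd' a3 e3
    rw [Int.isUnit_iff] at this
    omega
  have cce : IsCoprime c (9 * e) := by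
    apply IsCoprime.mul_right
    · have : IsCoprime c (3 ^ 2) :=
        (((Int.prime_three.coprime_iff_not_dvd).2 c3).symm).pow_right
      exact_mod_cast this
    · have : IsCoprime (a ^ 2) e := hae.pow_left
      rw [hc] at this
      have h2 : IsCoprime (c ^ 2) e := by
        have heq : c ^ 2 = 81 * e ^ 2 + c ^ 2 + e * (-81 * e) := by ring
        rw [heq]
        exact this.add_mul_left_left (-81 * e)
      exact (IsCoprime.pow_left_iff (by norm_num)).1 h2
  rcases Int.emod_two_eq_zero_or_one e with he2 | he2
  · -- `e` even
    have hb2 : b % 2 = 1 := by rcases not_both_even cbe with h | h <;> omega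
    have hc2 : c % 2 = 1 := by rcases not_both_even cce with h | h <;> omega
    obtain ⟨m, n, m1, m2, m3, m4, m5, m6⟩ := PythagoreanTriple.coprime_classification'
      (x := b) (y := e) (z := a) (by unfold PythagoreanTriple; linarith)
      (Int.isCoprime_iff_gcd_eq_one.1 cbe) hb2 ha
    obtain ⟨r, s, r1, r2, r3, r4, r5, r6⟩ := PythagoreanTriple.coprime_classification'
      (x := c) (y := 9 * e) (z := a) (by unfold PythagoreanTriple; linarith)
      (Int.isCoprime_iff_gcd_eq_one.1 cce) hc2 ha
    have hm : 0 < m := by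
      rcases m6.lt_or_eq with h | h
      · exact h
      · rw [← h] at m2; omega
    have hn : 0 < n := by nlinarith
    have hr : 0 < r := by
      rcases r6.lt_or_eq with h | h
      · exact h
      · rw [← h] at r2; omega
    have hs : 0 < s := by nlinarith
    have crs : IsCoprime r s := Int.isCoprime_iff_gcd_eq_one.2 r4
    have hrs : r * s = 9 * (m * n) := by linarith
    have h3 : (3 : ℤ) ∣ r * s := ⟨3 * (m * n), by linarith⟩
    have n9 : ∀ {r s : ℤ}, 0 < r → 0 < s → IsCoprime r s → r * s = 9 * (m * n) →
        r ^ 2 + s ^ 2 = m ^ 2 + n ^ 2 → (3 : ℤ) ∣ r → ∃ a' e', Conc a' e' ∧ e' < 2 * m * n := by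
      intro r s hr hs crs hrs hsum h3
      have ns : ¬ (3 : ℤ) ∣ s := by
        intro h
        have := crs.isUnit_of_dvd' h3 h
        rw [Int.isUnit_iff] at this
        omega
      have c9 : IsCoprime (9 : ℤ) s := by
        have : IsCoprime ((3 : ℤ) ^ 2) s :=
          (((Int.prime_three.coprime_iff_not_dvd).2 ns)).pow_left
        exact_mod_cast this
      obtain ⟨t, rfl⟩ : (9 : ℤ) ∣ r := c9.dvd_of_dvd_mul_right ⟨_, hrs⟩
      exact four_step hm hn (by omega) hs (IsCoprime.of_mul_left_right crs) (by linarith)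
        (by linarith)
    rw [m2]
    rcases Int.prime_three.dvd_or_dvd h3 with h | h
    · exact n9 hr hs crs hrs (by linarith) h
    · exact n9 hs hr crs.symm (by linarith) (by linarith) h
  · -- `e` odd
    exfalso
    have hpar : ∀ {c f : ℤ}, f % 2 = 1 → a ^ 2 = f ^ 2 + c ^ 2 → c % 2 = 0 := by
      intro c f hf h
      by_contra hc
      have h1 := odd_sq_mod hf
      have h2 := odd_sq_mod (x := c) (by omega)
      rcases Int.emod_two_eq_zero_or_one a with h3 | h3
      · have := even_sq_mod h3; omega
      · have := odd_sq_mod h3; omega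
    obtain ⟨m, n, m1, m2, m3, m4, m5, m6⟩ := PythagoreanTriple.coprime_classification'
      (x := e) (y := b) (z := a) (by unfold PythagoreanTriple; linarith)
      (Int.isCoprime_iff_gcd_eq_one.1 cbe.symm) he2 ha
    obtain ⟨r, s, r1, r2, r3, r4, r5, r6⟩ := PythagoreanTriple.coprime_classification'
      (x := 9 * e) (y := c) (z := a) (by unfold PythagoreanTriple; linarith)
      (Int.isCoprime_iff_gcd_eq_one.1 cce.symm) (by omega) ha
    have sr : ∀ x : ℤ, x ^ 2 % 8 = 0 ∨ x ^ 2 % 8 = 4 ∨ x ^ 2 % 8 = 1 := by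
      intro x
      rcases Int.emod_two_eq_zero_or_one x with h | h
      · have := even_sq_mod h; omega
      · have := odd_sq_mod h; omega
    have hr := sr r
    have hs := sr s
    rcases m5 with ⟨m5, m5'⟩ | ⟨m5, m5'⟩
    · have := even_sq_mod m5
      have := odd_sq_mod m5'
      omega
    · have := odd_sq_mod m5
      have := even_sq_mod m5'
      omega

theorem no_conc (N : ℕ) : ∀ a e : ℤ, Conc a e → e.toNat = N → False := by
  induction N using Nat.strong_induction_on with
  | _ N ih =>
    intro a e h hN
    obtain ⟨a', e', h', hlt⟩ := descent h
    have := h'.1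
    exact ih e'.toNat (by omega) a' e' h' rfl

theorem quartic {g b N : ℤ} (hg : 0 < g) (hb : 0 < b) (h : IsCoprime g b)
    (hN : (g ^ 2 - b ^ 2) * (g ^ 2 - 81 * b ^ 2) = N ^ 2) : N = 0 := by
  by_contra hN0
  have hX : g ^ 2 - b ^ 2 ≠ 0 := by rintro h0; exact hN0 (pow_eq_zero_iff (two_ne_zero)|>.1 (by rw [← hN, h0]; ring))
  have hY : g ^ 2 - 81 * b ^ 2 ≠ 0 := by rintro h0; exact hN0 (pow_eq_zero_iff (two_ne_zero)|>.1 (by rw [← hN, h0]; ring))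
  obtain ⟨X, Y, hXY, h1, h2⟩ := Int.exists_gcd_one (m := g ^ 2 - b ^ 2) (n := g ^ 2 - 81 * b ^ 2)
    (by exact_mod_cast Int.gcd_pos_of_ne_zero_left _ hX)
  have hd : (0 : ℤ) < (Int.gcd (g ^ 2 - b ^ 2) (g ^ 2 - 81 * b ^ 2) : ℤ) := by
    exact_mod_cast Int.gcd_pos_of_ne_zero_left _ hX
  generalize (Int.gcd (g ^ 2 - b ^ 2) (g ^ 2 - 81 * b ^ 2) : ℤ) = d at *
  obtain ⟨M, rfl⟩ : d ∣ N := by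
    rw [← Int.pow_dvd_pow_iff (n := 2) (by norm_num), ← hN, h1, h2]
    exact ⟨X * Y, by ring⟩
  have hM : X * Y = M ^ 2 := by
    have : d ^ 2 * (X * Y) = d ^ 2 * M ^ 2 := by rw [h1, h2] at hN; linarith
    exact mul_left_cancel₀ (by positivity) this
  obtain ⟨x, hx⟩ := Int.sq_of_gcd_eq_one hXY hM
  obtain ⟨y, hy⟩ := Int.sq_of_gcd_eq_one (by rwa [Int.gcd_comm]) ((mul_comm Y X).trans hM)
  have hX0 : X ≠ 0 := by rintro rfl; simp at h1; exact hX h1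
  have hY0 : Y ≠ 0 := by rintro rfl; simp at h2; exact hY h2
  have x0 : x ≠ 0 := by rintro rfl; simp at hx; exact hX0 hx
  have y0 : y ≠ 0 := by rintro rfl; simp at hy; exact hY0 hy
  have hx2 : 0 < x ^ 2 := by positivity
  have hy2 : 0 < y ^ 2 := by positivity
  have hp : 0 < X * Y := by
    rw [hM]
    have : M ≠ 0 := by rintro rfl; simp at hN0
    positivity
  have cXY : IsCoprime X Y := Int.isCoprime_iff_gcd_eq_one.2 hXY
  have key : ∃ k : ℤ, g ^ 2 - b ^ 2 = k * |x| ^ 2 ∧ g ^ 2 - 81 * b ^ 2 = k * |y| ^ 2 := by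
    simp only [sq_abs]
    rcases hx with hx | hx <;> rcases hy with hy | hy
    · exact ⟨d, by rw [h1, hx]; ring, by rw [h2, hy]; ring⟩
    · exfalso; rw [hx, hy] at hp; nlinarith
    · exfalso; rw [hx, hy] at hp; nlinarith
    · exact ⟨-d, by rw [h1, hx]; ring, by rw [h2, hy]; ring⟩
  have cxy : IsCoprime (|x|) (|y|) := by
    have : IsCoprime (x ^ 2) (y ^ 2) := by
      rcases hx with hx | hx <;> rcases hy with hy | hy <;> rw [hx, hy] at cXY <;>
        simpa only [IsCoprime.neg_left_iff, IsCoprime.neg_right_iff] using cXY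
    rw [← sq_abs x, ← sq_abs y] at this
    exact (IsCoprime.pow_iff (by norm_num) (by norm_num)).1 this
  obtain ⟨k, k1, k2⟩ := key
  obtain ⟨a, e, h3, -⟩ := conc_of_any hg hb (abs_pos.2 x0) (abs_pos.2 y0) h cxy k1 k2
  exact no_conc _ a e h3 rfl

theorem rat_points {v Y : ℚ} (h : v * (v + 16) * (v + 25) = Y ^ 2) :
    v = 0 ∨ v = -16 ∨ v = -25 ∨ v = 20 ∨ v = -20 := by
  by_cases hv : v = 0
  · exact Or.inl hv
  by_cases hY : Y = 0
  · rw [hY] at h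
    have : v * (v + 16) * (v + 25) = 0 := by simpa using h
    rcases mul_eq_zero.1 this with h | h
    · rcases mul_eq_zero.1 h with h | h
      · exact Or.inl h
      · exact Or.inr (Or.inl (by linarith))
    · exact Or.inr (Or.inr (Or.inl (by linarith)))
  have hr : 0 < |Y / v| := abs_pos.2 (div_ne_zero hY hv)
  obtain ⟨r, hr0⟩ : ∃ r, r = |Y / v| := ⟨_, rfl⟩
  have hr2 : r ^ 2 = (v + 16) * (v + 25) / v := by
    rw [hr0, sq_abs, div_pow, ← h]; field_simp
  rw [← hr0] at hr
  have hq : (r ^ 2 - 1) * (r ^ 2 - 81) = (v - 400 / v) ^ 2 := by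
    rw [hr2]; field_simp; ring
  have hden : (r.den : ℚ) ≠ 0 := by exact_mod_cast r.den_nz
  have hrr : r * r.den = r.num := Rat.mul_den_eq_num r
  have hz : ((((r.num ^ 2 - r.den ^ 2) * (r.num ^ 2 - 81 * r.den ^ 2) : ℤ)) : ℚ)
      = ((v - 400 / v) * r.den ^ 2) ^ 2 := by
    push_cast
    rw [← hrr, mul_pow, mul_pow, ← hq]; ring
  have hsq : IsSquare ((r.num ^ 2 - r.den ^ 2) * (r.num ^ 2 - 81 * r.den ^ 2) : ℤ) := by
    rw [← Rat.isSquare_intCast_iff, hz]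
    exact ⟨_, sq _⟩
  obtain ⟨N, hN⟩ := hsq
  have hN0 := quartic (g := r.num) (b := r.den) (N := N) (Rat.num_pos.2 hr)
    (by exact_mod_cast r.den_pos)
    (by rw [Int.isCoprime_iff_gcd_eq_one]; exact r.reduced) (by rw [hN]; ring)
  rw [hN, hN0] at hz
  have : (v - 400 / v) = 0 := by
    have h3 : (v - 400 / v) * (r.den : ℚ) ^ 2 = 0 :=
      (pow_eq_zero_iff two_ne_zero).1 (by rw [← hz]; simp)
    exact (mul_eq_zero.1 h3).resolve_right (pow_ne_zero 2 hden)
  have h2 : (v - 20) * (v + 20) = 0 := by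
    field_simp at this
    linarith
  rcases mul_eq_zero.1 h2 with h | h
  · exact Or.inr (Or.inr (Or.inr (Or.inl (by linarith))))
  · exact Or.inr (Or.inr (Or.inr (Or.inr (by linarith))))

open WeierstrassCurve.Affine in
theorem E₁_ns {x y : ℚ} : E₁.Nonsingular x y ↔
    y ^ 2 + x * y + y = x ^ 3 + x ^ 2 - 10 * x - 10 ∧
      (y ≠ 3 * x ^ 2 + 2 * x - 10 ∨ y ≠ -y - x - 1) := by
  rw [WeierstrassCurve.Affine.nonsingular_iff, WeierstrassCurve.Affine.equation_iff]
  simp only [E₁]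
  ring_nf

/-- the point constructor with the conditions spelled out -/
def mkP (x y : ℚ) (h : y ^ 2 + x * y + y = x ^ 3 + x ^ 2 - 10 * x - 10 ∧
      (y ≠ 3 * x ^ 2 + 2 * x - 10 ∨ y ≠ -y - x - 1)) : E₁.Point :=
  WeierstrassCurve.Affine.Point.some x y (E₁_ns.2 h)

theorem mkP_add_ne {x₁ y₁ x₂ y₂ x₃ y₃ : ℚ} {h₁ h₂ h₃} (l : ℚ) (hx : x₁ ≠ x₂)
    (hl : l * (x₁ - x₂) = y₁ - y₂) (e1 : x₃ = l ^ 2 + l - 1 - x₁ - x₂)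
    (e2 : y₃ = -(l * (x₃ - x₁) + y₁) - x₃ - 1) :
    mkP x₁ y₁ h₁ + mkP x₂ y₂ h₂ = mkP x₃ y₃ h₃ := by
  have hs : E₁.slope x₁ x₂ y₁ y₂ = l := by
    rw [WeierstrassCurve.Affine.slope_of_X_ne hx, ← hl]
    exact mul_div_cancel_right₀ _ (sub_ne_zero.2 hx)
  unfold mkP
  rw [WeierstrassCurve.Affine.Point.add_of_X_ne hx, WeierstrassCurve.Affine.Point.some.injEq]
  subst e1 e2
  rw [hs]
  simp only [WeierstrassCurve.Affine.addX, WeierstrassCurve.Affine.addY,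
    WeierstrassCurve.Affine.negAddY, WeierstrassCurve.Affine.negY, E₁]
  constructor <;> ring

theorem mkP_dbl {x₁ y₁ x₃ y₃ : ℚ} {h₁ h₃} (l : ℚ) (hx : y₁ - (-y₁ - x₁ - 1) ≠ 0)
    (hl : l * (y₁ - (-y₁ - x₁ - 1)) = 3 * x₁ ^ 2 + 2 * x₁ - 10 - y₁)
    (e1 : x₃ = l ^ 2 + l - 1 - x₁ - x₁)
    (e2 : y₃ = -(l * (x₃ - x₁) + y₁) - x₃ - 1) :
    mkP x₁ y₁ h₁ + mkP x₁ y₁ h₁ = mkP x₃ y₃ h₃ := by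
  have hn : E₁.negY x₁ y₁ = -y₁ - x₁ - 1 := by simp [WeierstrassCurve.Affine.negY, E₁]
  have hy : y₁ ≠ E₁.negY x₁ y₁ := by rw [hn]; exact sub_ne_zero.1 hx
  have hs : E₁.slope x₁ x₁ y₁ y₁ = l := by
    rw [WeierstrassCurve.Affine.slope_of_Y_ne rfl hy, hn, div_eq_iff hx, hl]
    simp only [E₁]; ring
  unfold mkP
  rw [WeierstrassCurve.Affine.Point.add_self_of_Y_ne hy, WeierstrassCurve.Affine.Point.some.injEq]
  subst e1 e2
  rw [hs]
  simp only [WeierstrassCurve.Affine.addX, WeierstrassCurve.Affine.addY,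
    WeierstrassCurve.Affine.negAddY, WeierstrassCurve.Affine.negY, E₁]
  constructor <;> ring

theorem mkP_two {x₁ y₁ : ℚ} {h₁} (hx : y₁ = (-y₁ - x₁ - 1)) :
    mkP x₁ y₁ h₁ + mkP x₁ y₁ h₁ = 0 := by
  apply WeierstrassCurve.Affine.Point.add_self_of_Y_eq
  simpa [WeierstrassCurve.Affine.negY, E₁] using hx

theorem mkP_ne_zero {x y : ℚ} {h} : mkP x y h ≠ 0 :=
  WeierstrassCurve.Affine.Point.some_ne_zero _

def pP : E₁.Point := mkP 8 18 (by norm_num)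
def p2 : E₁.Point := mkP 3 (-2) (by norm_num)
def p3 : E₁.Point := mkP 8 (-27) (by norm_num)
def pT : E₁.Point := mkP (-1) 0 (by norm_num)
def pT2 : E₁.Point := mkP (-13/4) (9/8) (by norm_num)
def pTa : E₁.Point := mkP (-2) (-2) (by norm_num)
def pTb : E₁.Point := mkP (-2) 3 (by norm_num)

theorem add_PP : pP + pP = p2 := mkP_dbl 4 (by norm_num) (by norm_num) (by norm_num) (by norm_num)
theorem add_22 : p2 + p2 = 0 := mkP_two (by norm_num)
theorem add_2P : p2 + pP = p3 :=
  mkP_add_ne 4 (by norm_num) (by norm_num) (by norm_num) (by norm_num)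
theorem add_TT : pT + pT = 0 := mkP_two (by norm_num)
theorem add_TP : pT + pP = pTb :=
  mkP_add_ne 2 (by norm_num) (by norm_num) (by norm_num) (by norm_num)
theorem add_T2 : pT + p2 = pT2 :=
  mkP_add_ne (-1/2) (by norm_num) (by norm_num) (by norm_num) (by norm_num)
theorem add_T3 : pT + p3 = pTa :=
  mkP_add_ne (-3) (by norm_num) (by norm_num) (by norm_num) (by norm_num)

theorem all_points (Q : E₁.Point) : Q = 0 ∨ Q = pP ∨ Q = p2 ∨ Q = p3 ∨ Q = pT ∨ Q = pTb ∨
    Q = pT2 ∨ Q = pTa := by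
  rcases Q with _ | ⟨x, y, h⟩
  · exact Or.inl rfl
  right
  have h' := (E₁_ns.1 h).1
  have key := rat_points (v := 4 * x - 12) (Y := 4 * (2 * y + x + 1)) (by linear_combination -64 * h')
  simp only [pP, p2, p3, pT, pTb, pT2, pTa, mkP, WeierstrassCurve.Affine.Point.some.injEq]
  rcases key with hx | hx | hx | hx | hx
  · obtain rfl : x = 3 := by linarith
    have : (y + 2) ^ 2 = 0 := by linear_combination h'
    have : y = -2 := by linarith [(pow_eq_zero_iff two_ne_zero).1 this]
    simp [this]
  · obtain rfl : x = -1 := by linarith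
    have : y ^ 2 = 0 := by linear_combination h'
    have : y = 0 := (pow_eq_zero_iff two_ne_zero).1 this
    simp [this]
  · obtain rfl : x = -13/4 := by linarith
    have : (y - 9/8) ^ 2 = 0 := by linear_combination h'
    have : y = 9/8 := by linarith [(pow_eq_zero_iff two_ne_zero).1 this]
    simp [this]
  · obtain rfl : x = 8 := by linarith
    have : (y - 18) * (y + 27) = 0 := by linear_combination h'
    rcases mul_eq_zero.1 this with h | h
    · have : y = 18 := by linarith
      simp [this]
    · have : y = -27 := by linarith
      simp [this]
  · obtain rfl : x = -2 := by linarith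
    have : (y - 3) * (y + 2) = 0 := by linear_combination h'
    rcases mul_eq_zero.1 this with h | h
    · have : y = 3 := by linarith
      simp [this]
    · have : y = -2 := by linarith
      simp [this]

/-- The homomorphism `(i, j) ↦ i T + j P`. -/
noncomputable def theHom : ZMod 2 × ZMod 4 →+ E₁.Point :=
  AddMonoidHom.coprod
    (ZMod.lift 2 ⟨zmultiplesHom _ pT, by
      simp only [zmultiplesHom_apply, Nat.cast_ofNat, ofNat_zsmul, two_nsmul, add_TT]⟩)
    (ZMod.lift 4 ⟨zmultiplesHom _ pP, by
      have : ((4 : ℕ) : ℤ) • pP = (pP + pP) + (pP + pP) := by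
        rw [natCast_zsmul]; abel
      rw [zmultiplesHom_apply, this, add_PP, add_22]⟩)

theorem theHom_apply (i j : ℤ) : theHom ((i : ZMod 2), (j : ZMod 4)) = i • pT + j • pP := by
  simp [theHom]

/-- The group of rational points of `E₁ : y² + xy + y = x³ + x² − 10x − 10` over `ℚ`
(Cremona label 15A1) is isomorphic to `ℤ/2ℤ ⊕ ℤ/4ℤ`. -/
theorem E₁_rational_points_iso :
    Nonempty (E₁.Point ≃+ (ZMod 2 × ZMod 4)) := by
  have t2 : (2 : ℤ) • pP = p2 := by rw [two_zsmul, add_PP]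
  have t3 : (3 : ℤ) • pP = p3 := by
    rw [← add_2P, ← add_PP]; abel
  have v00 : theHom (0, 0) = 0 := by simpa using theHom_apply 0 0
  have v01 : theHom (0, 1) = pP := by simpa using theHom_apply 0 1
  have v02 : theHom (0, 2) = p2 := by simpa [t2] using theHom_apply 0 2
  have v03 : theHom (0, 3) = p3 := by simpa [t3] using theHom_apply 0 3
  have v10 : theHom (1, 0) = pT := by simpa using theHom_apply 1 0
  have v11 : theHom (1, 1) = pTb := by simpa [add_TP] using theHom_apply 1 1
  have v12 : theHom (1, 2) = pT2 := by simpa [t2, add_T2] using theHom_apply 1 2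
  have v13 : theHom (1, 3) = pTa := by simpa [t3, add_T3] using theHom_apply 1 3
  have inj : Function.Injective theHom := by
    rw [injective_iff_map_eq_zero]
    rintro ⟨i, j⟩ h
    have hi : i = 0 ∨ i = 1 := by clear h; revert i; decide
    have hj : j = 0 ∨ j = 1 ∨ j = 2 ∨ j = 3 := by clear h; revert j; decide
    rcases hi with rfl | rfl <;> rcases hj with rfl | rfl | rfl | rfl
    · rfl
    · exact (mkP_ne_zero (v01.symm.trans h)).elim
    · exact (mkP_ne_zero (v02.symm.trans h)).elim
    · exact (mkP_ne_zero (v03.symm.trans h)).elim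
    · exact (mkP_ne_zero (v10.symm.trans h)).elim
    · exact (mkP_ne_zero (v11.symm.trans h)).elim
    · exact (mkP_ne_zero (v12.symm.trans h)).elim
    · exact (mkP_ne_zero (v13.symm.trans h)).elim
  have surj : Function.Surjective theHom := by
    intro Q
    rcases all_points Q with rfl | rfl | rfl | rfl | rfl | rfl | rfl | rfl
    exacts [⟨_, v00⟩, ⟨_, v01⟩, ⟨_, v02⟩, ⟨_, v03⟩, ⟨_, v10⟩, ⟨_, v11⟩, ⟨_, v12⟩, ⟨_, v13⟩]
  exact ⟨(AddEquiv.ofBijective theHom ⟨inj, surj⟩).symm⟩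
end

section
/- The group of rational points of the elliptic curve E₂ : y² + xy + y = x³ + x² − 5x + 2 over ℚ (Cremona label 15A3) is isomorphic to ℤ/2ℤ ⊕ ℤ/4ℤ. -/
/-- `E₂ : y² + xy + y = x³ + x² − 5x + 2`, the elliptic curve of Cremona label 15A3,
viewed as a Weierstrass curve over `ℚ` in affine coordinates. -/
def E₂ : WeierstrassCurve.Affine ℚ :=
  { a₁ := 1, a₂ := 1, a₃ := 1, a₄ := -5, a₆ := 2 }


theorem sq8 {x : ℤ} (hx : Odd x) : x ^ 2 % 8 = 1 := by
  obtain ⟨k, rfl⟩ := hx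
  obtain ⟨j, hj⟩ := (Int.even_mul_succ_self k).two_dvd
  have : (2 * k + 1) ^ 2 = 8 * j + 1 := by linear_combination 4 * hj
  omega

theorem desc_step (a b c d : ℤ) (h1 : 4 * (a * b) = c * d) (h2 : a ^ 2 - b ^ 2 = c ^ 2 - d ^ 2)
    (ha : Odd a) (hc : Odd c) (hab : IsCoprime a b) (hb : b ≠ 0) :
    ∃ α δ β γ : ℤ, α ^ 2 + δ ^ 2 = β ^ 2 ∧ α ^ 2 + 16 * δ ^ 2 = γ ^ 2 ∧ IsCoprime α δ ∧ Odd α ∧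
      δ ≠ 0 ∧ δ.natAbs < (2 * a * b).natAbs := by
  have ha0 : a ≠ 0 := by rintro rfl; simp at ha
  have h4c : IsCoprime (4 : ℤ) c := by
    obtain ⟨k, rfl⟩ := hc
    have h2 : IsCoprime (2 : ℤ) (2 * k + 1) := ⟨-k, 1, by ring⟩
    have := h2.pow_left (m := 2)
    norm_num at this
    exact this
  obtain ⟨d', rfl⟩ : (4 : ℤ) ∣ d := h4c.dvd_of_dvd_mul_left ⟨a * b, h1.symm⟩
  obtain ⟨β, γ, hβγ, hA, hC⟩ : ∃ β γ : ℤ, IsCoprime β γ ∧ a = β * (Int.gcd a c : ℤ) ∧ c = γ * (Int.gcd a c : ℤ) := by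
    have hg : 0 < Int.gcd a c := Int.gcd_pos_of_ne_zero_left _ ha0
    obtain ⟨β, γ, h, h', h''⟩ := Int.exists_gcd_one hg
    exact ⟨β, γ, Int.isCoprime_iff_gcd_eq_one.2 h, h', h''⟩
  generalize (Int.gcd a c : ℤ) = α at hA hC
  subst hA hC
  have hα0 : α ≠ 0 := by rintro rfl; simp at ha0
  have hβ0 : β ≠ 0 := by rintro rfl; simp at ha0
  have e1 : β * b = γ * d' := by
    have : (4 * α) * (β * b) = (4 * α) * (γ * d') := by linarith
    exact mul_left_cancel₀ (by simpa using hα0) this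
  obtain ⟨δ, rfl⟩ : γ ∣ b := hβγ.symm.dvd_of_dvd_mul_left ⟨d', e1⟩
  have hγ0 : γ ≠ 0 := by rintro rfl; simp at hb
  have hδ0 : δ ≠ 0 := by rintro rfl; simp at hb
  obtain rfl : d' = β * δ := by
    apply mul_left_cancel₀ hγ0; linarith
  have hαδ : IsCoprime α δ := (hab.of_mul_left_right).of_mul_right_right
  have e2 : α ^ 2 * (β ^ 2 - γ ^ 2) = δ ^ 2 * (γ ^ 2 - 16 * β ^ 2) := by linear_combination h2
  obtain ⟨k, hk⟩ : α ^ 2 ∣ γ ^ 2 - 16 * β ^ 2 :=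
    (hαδ.pow (m := 2) (n := 2)).dvd_of_dvd_mul_left ⟨_, e2.symm⟩
  have hk2 : β ^ 2 - γ ^ 2 = δ ^ 2 * k := by
    apply mul_left_cancel₀ (pow_ne_zero 2 hα0); rw [e2, hk]; ring
  have k15 : k ∣ 15 := by
    have c1 : k ∣ 15 * β ^ 2 := ⟨-(α ^ 2 + δ ^ 2), by linear_combination -hk - hk2⟩
    have c2 : k ∣ 15 * γ ^ 2 := ⟨-(α ^ 2 + 16 * δ ^ 2), by linear_combination -hk - 16 * hk2⟩
    obtain ⟨x, y, hxy⟩ := hβγ.pow (m := 2) (n := 2)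
    have : (15 : ℤ) = x * (15 * β ^ 2) + y * (15 * γ ^ 2) := by linear_combination -15 * hxy
    rw [this]
    exact dvd_add (c1.mul_left _) (c2.mul_left _)
  have hαo : Odd α := (Int.odd_mul.1 ha).2
  have hγo : Odd γ := (Int.odd_mul.1 hc).1
  have k8 : k % 8 = 1 := by
    have s1 : α ^ 2 % 8 = 1 := sq8 hαo
    have s2 : γ ^ 2 % 8 = 1 := sq8 hγo
    have : (α ^ 2 * k) % 8 = k % 8 := by rw [Int.mul_emod, s1]; simp
    omega
  have hkl : k ≤ 15 := Int.le_of_dvd (by norm_num) k15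
  have hkg : -15 ≤ k := by
    have := Int.le_of_dvd (by norm_num) ((neg_dvd).2 k15); omega
  have hk' : k = 1 ∨ k = -15 := by
    obtain ⟨l, hl⟩ := k15
    interval_cases k <;> omega
  rcases hk' with rfl | rfl
  · exfalso
    have : 0 < β ^ 2 := by positivity
    nlinarith [sq_nonneg α, sq_nonneg δ]
  · refine ⟨α, δ, β, γ, by linarith, by linarith, hαδ, hαo, hδ0, ?_⟩
    simp only [Int.natAbs_mul]
    have p1 := Int.natAbs_pos.2 hα0
    have p2 := Int.natAbs_pos.2 hβ0
    have p3 := Int.natAbs_pos.2 hγ0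
    have p4 := Int.natAbs_pos.2 hδ0
    have : 1 ≤ β.natAbs * α.natAbs * γ.natAbs := Nat.mul_pos (Nat.mul_pos p2 p1) p3
    have h22 : (2 : ℤ).natAbs = 2 := rfl
    rw [h22]
    nlinarith

theorem desc_int (n : ℕ) : ∀ r s t q : ℤ, s.natAbs = n → r ^ 2 + s ^ 2 = t ^ 2 →
    r ^ 2 + 16 * s ^ 2 = q ^ 2 → IsCoprime r s → Odd r → s = 0 := by
  induction n using Nat.strong_induction_on with
  | _ n ih =>
  intro r s t q hn h1 h2 hrs hr
  by_contra hs
  have hr1 : r % 2 = 1 := Int.odd_iff.1 hr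
  have key : ∀ z w : ℤ, IsCoprime r z → r ^ 2 + z ^ 2 = w ^ 2 → ∃ m n : ℤ, r = m ^ 2 - n ^ 2 ∧ z = 2 * m * n ∧
      IsCoprime m n ∧ (m % 2 = 0 ∧ n % 2 = 1 ∨ m % 2 = 1 ∧ n % 2 = 0) := by
    intro z w hz hw
    have ht : PythagoreanTriple r z w := by unfold PythagoreanTriple; linarith
    obtain ⟨m, n, h, -, h', h''⟩ := PythagoreanTriple.coprime_classification.1 ⟨ht, Int.isCoprime_iff_gcd_eq_one.1 hz⟩
    rcases h with ⟨h, h3⟩ | ⟨h, h3⟩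
    · exact ⟨m, n, h, h3, Int.isCoprime_iff_gcd_eq_one.2 h', h''⟩
    · exfalso
      rw [h, mul_assoc] at hr1; omega
  have h4r : IsCoprime r 4 := by
    obtain ⟨k, rfl⟩ := hr
    have h2 : IsCoprime (2 * k + 1) (2 : ℤ) := ⟨1, -k, by ring⟩
    have := h2.pow_right (n := 2)
    norm_num at this
    exact this
  obtain ⟨a, b, hra, hsa, hab, hpa⟩ := key s t hrs h1
  obtain ⟨c, d, hrc, hsc, hcd, hpc⟩ := key (4 * s) q (h4r.mul_right hrs) (by linarith)
  have ha0 : a ≠ 0 := by rintro rfl; simp at hsa; exact hs hsa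
  have hb0 : b ≠ 0 := by rintro rfl; simp at hsa; exact hs hsa
  have parsq : ∀ x : ℤ, x % 2 = 1 → x ^ 2 % 4 = 1 := fun x hx =>
    Int.sq_mod_four_eq_one_of_odd (Int.odd_iff.2 hx)
  have parsq0 : ∀ x : ℤ, x % 2 = 0 → x ^ 2 % 4 = 0 := by
    intro x hx
    obtain ⟨y, rfl⟩ := Int.dvd_of_emod_eq_zero hx
    ring_nf; omega
  have fin : ∃ α δ β γ : ℤ, α ^ 2 + δ ^ 2 = β ^ 2 ∧ α ^ 2 + 16 * δ ^ 2 = γ ^ 2 ∧ IsCoprime α δ ∧ Odd α ∧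
      δ ≠ 0 ∧ δ.natAbs < s.natAbs := by
    rcases hpa with ⟨pa, pb⟩ | ⟨pa, pb⟩ <;> rcases hpc with ⟨pc, pd⟩ | ⟨pc, pd⟩
    · have := desc_step b a d c (by linarith) (by linarith) (Int.odd_iff.2 pb) (Int.odd_iff.2 pd) hab.symm ha0
      rw [hsa, show 2 * a * b = 2 * b * a by ring]; exact this
    · have := parsq b pb; have := parsq c pc; have := parsq0 a pa; have := parsq0 d pd; omega
    · have := parsq a pa; have := parsq d pd; have := parsq0 b pb; have := parsq0 c pc; omega
    · rw [hsa]
      exact desc_step a b c d (by linarith) (by linarith) (Int.odd_iff.2 pa) (Int.odd_iff.2 pc) hab hb0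
  obtain ⟨α, δ, β, γ, e1, e2, e3, e4, e5, e6⟩ := fin
  exact e5 (ih _ (hn ▸ e6) α δ β γ rfl e1 e2 e3 e4)

theorem rat_sq_int {n : ℤ} {t : ℚ} (h : (n : ℚ) = t ^ 2) : ∃ k : ℤ, n = k ^ 2 := by
  have : IsSquare ((n : ℤ) : ℚ) := ⟨t, by rw [h]; ring⟩
  rw [Rat.isSquare_intCast_iff] at this
  obtain ⟨k, hk⟩ := this
  exact ⟨k, by rw [hk]; ring⟩

/-- The trivial class. -/
theorem desc_rat (ρ τ θ : ℚ) (h1 : ρ ^ 2 + 1 = τ ^ 2) (h2 : ρ ^ 2 + 16 = θ ^ 2) : ρ = 0 := by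
  have hd : (ρ.den : ℚ) ≠ 0 := by exact_mod_cast ρ.den_nz
  have hρ : ρ * ρ.den = ρ.num := Rat.mul_den_eq_num ρ
  obtain ⟨t, ht⟩ := rat_sq_int (n := ρ.num ^ 2 + (ρ.den : ℤ) ^ 2) (t := τ * ρ.den) (by
    push_cast; rw [← hρ, mul_pow τ, ← h1]; ring)
  obtain ⟨q, hq⟩ := rat_sq_int (n := ρ.num ^ 2 + 16 * (ρ.den : ℤ) ^ 2) (t := θ * ρ.den) (by
    push_cast; rw [← hρ, mul_pow θ, ← h2]; ring)
  have hcop : IsCoprime ρ.num (ρ.den : ℤ) := by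
    rw [Int.isCoprime_iff_gcd_eq_one]; exact ρ.reduced
  have hdz : (ρ.den : ℤ) ≠ 0 := by exact_mod_cast ρ.den_nz
  generalize hs : (ρ.den : ℤ) = s at *
  generalize hr : ρ.num = r at *
  rcases Int.even_or_odd r with he | ho
  · have hso : Odd s := by
      by_contra h
      rw [Int.not_odd_iff_even] at h
      have := hcop.isUnit_of_dvd' he.two_dvd h.two_dvd
      norm_num [Int.isUnit_iff] at this
    have h8 : s ^ 2 % 8 = 1 := sq8 hso
    obtain ⟨r', rfl⟩ := he.two_dvd
    have hto : Odd t := by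
      by_contra h
      rw [Int.not_odd_iff_even] at h
      obtain ⟨t', rfl⟩ := h.two_dvd
      ring_nf at ht h8; omega
    have t8 : t ^ 2 % 8 = 1 := sq8 hto
    have hre : Even r' := by
      by_contra h
      rw [Int.not_even_iff_odd] at h
      have := sq8 h
      ring_nf at ht h8; omega
    obtain ⟨r1, rfl⟩ := hre.two_dvd
    obtain ⟨q1, rfl⟩ : (4 : ℤ) ∣ q := by
      have : (4 : ℤ) ^ 2 ∣ q ^ 2 := ⟨r1 ^ 2 + s ^ 2, by rw [← hq]; ring⟩
      exact (Int.pow_dvd_pow_iff (by norm_num)).1 this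
    have := desc_int _ s r1 q1 t rfl (by linarith) (by linarith)
      hcop.symm.of_mul_right_right.of_mul_right_right hso
    subst this
    simpa using hr
  · exact absurd (desc_int _ r s t q rfl ht hq hcop ho) hdz

theorem no_sum_sq_int (k : ℕ) (hk : k = 3 ∨ k = 15) (a b c : ℕ) (hc : c ≠ 0) : k * c ^ 2 ≠ a ^ 2 + b ^ 2 := by
  intro h
  have h' := (Nat.eq_sq_add_sq_iff (n := k * c ^ 2)).1 ⟨a, b, h⟩
  have hk0 : k ≠ 0 := by omega
  have := h' (q := 3) (by
    rw [Nat.mem_primeFactors]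
    refine ⟨by norm_num, Dvd.dvd.mul_right (by omega) _, by positivity⟩) (by norm_num)
  have hF : Fact (Nat.Prime 3) := ⟨by norm_num⟩
  rw [padicValNat.mul hk0 (by positivity), padicValNat.pow] at this
  have hv : padicValNat 3 k = 1 := by
    rcases hk with rfl | rfl
    · simp
    · rw [show 15 = 3 * 5 by norm_num, padicValNat.mul (by norm_num) (by norm_num)]
      simp [padicValNat.eq_zero_of_not_dvd]
  rw [hv] at this
  rw [Nat.even_iff] at this; omega

theorem no_sum_sq (k : ℕ) (hk : k = 3 ∨ k = 15) (a b c : ℚ) (hc : c ≠ 0) : k * c ^ 2 ≠ a ^ 2 + b ^ 2 := by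
  intro h
  have ea : a * a.den = a.num := Rat.mul_den_eq_num a
  have eb : b * b.den = b.num := Rat.mul_den_eq_num b
  have ec : c * c.den = c.num := Rat.mul_den_eq_num c
  apply no_sum_sq_int k hk (a.num * b.den * c.den).natAbs (b.num * a.den * c.den).natAbs
    (c.num * a.den * b.den).natAbs
  · simp [hc]
  · zify
    simp only [sq_abs]
    have : ((k * (c.num * a.den * b.den) ^ 2 : ℤ) : ℚ) = ((a.num * b.den * c.den) ^ 2 + (b.num * a.den * c.den) ^ 2 : ℤ) := by
      push_cast
      rw [← ea, ← eb, ← ec]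
      linear_combination (a.den * b.den * c.den : ℚ) ^ 2 * h
    exact_mod_cast this

theorem sqfree_decomp (n : ℤ) : ∃ d x : ℤ, n = d * x ^ 2 ∧ Squarefree d := by
  obtain ⟨a, b, h, hs⟩ := Nat.sq_mul_squarefree n.natAbs
  have hs' : Squarefree (a : ℤ) := Int.squarefree_natCast.2 hs
  have h' : (n.natAbs : ℤ) = b ^ 2 * a := by exact_mod_cast h.symm
  rcases Int.natAbs_eq n with e | e
  · exact ⟨a, b, by rw [e, h']; ring, hs'⟩
  · exact ⟨-a, b, by rw [e, h']; ring, by rw [← Int.squarefree_natAbs]; simpa using hs⟩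

theorem sqfree_dvd {d x k N : ℤ} (hd : Squarefree d) (hx : x ≠ 0) (h : d * x ^ 2 * k = N ^ 2) : d ∣ k := by
  obtain ⟨M, rfl⟩ : x ∣ N := by
    have : x ^ 2 ∣ N ^ 2 := ⟨d * k, by rw [← h]; ring⟩
    exact (Int.pow_dvd_pow_iff (by norm_num)).1 this
  have h2 : d * k = M ^ 2 := by
    apply mul_left_cancel₀ (pow_ne_zero 2 hx); linarith
  obtain ⟨L, rfl⟩ : d ∣ M := hd.isRadical 2 M ⟨k, h2.symm⟩
  have hd0 := hd.ne_zero
  exact ⟨L ^ 2, by apply mul_left_cancel₀ hd0; linarith⟩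

theorem kill_two (ε x e N : ℤ) (hε : ε = 1 ∨ ε = -1) (hx : x ≠ 0) (he : Odd e)
    (h : (ε * 2 * x ^ 2) * (ε * 2 * x ^ 2 + e ^ 2) * (ε * 2 * x ^ 2 + 16 * e ^ 2) = N ^ 2) : False := by
  have hε2 : ε ^ 2 = 1 := by rcases hε with rfl | rfl <;> norm_num
  obtain ⟨M, rfl⟩ : 2 * x ∣ N := by
    have : (2 * x) ^ 2 ∣ N ^ 2 := ⟨(e ^ 2 + 2 * ε * x ^ 2) * (ε ^ 2 * x ^ 2 + 8 * ε * e ^ 2), by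
      rw [← h]; ring⟩
    exact (Int.pow_dvd_pow_iff (by norm_num)).1 this
  have h2 : (e ^ 2 + 2 * ε * x ^ 2) * (x ^ 2 + 8 * ε * e ^ 2) = M ^ 2 := by
    apply mul_left_cancel₀ (pow_ne_zero 2 (mul_ne_zero two_ne_zero hx))
    linear_combination h - (4 * x ^ 2) * (e ^ 2 + 2 * ε * x ^ 2) * x ^ 2 * hε2
  have e8 := sq8 he
  have dec : ∀ e x m f : ZMod 8, e = 1 → f = 1 ∨ f = -1 →
      (e + 2 * f * x ^ 2) * (x ^ 2 + 8 * f * e) = m ^ 2 → x ^ 2 ≠ 1 := by decide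
  have dec2 : ∀ e x m f : ZMod 8, e = 1 → f = 1 ∨ f = -1 →
      (e + 8 * f * x ^ 2) * (x ^ 2 + 2 * f * e) ≠ m ^ 2 := by decide
  have ez : ((e : ZMod 8)) ^ 2 = 1 := by
    have : ((e ^ 2 : ℤ) : ZMod 8) = ((1 : ℤ) : ZMod 8) := (ZMod.intCast_eq_intCast_iff' _ _ 8).2 (by simpa using e8)
    simpa using this
  have fz : ((ε : ℤ) : ZMod 8) = 1 ∨ ((ε : ℤ) : ZMod 8) = -1 := by
    rcases hε with rfl | rfl <;> simp
  rcases Int.even_or_odd x with hxe | hxo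
  · obtain ⟨y, rfl⟩ := hxe.two_dvd
    obtain ⟨L, rfl⟩ : 2 ∣ M := by
      have : (2 : ℤ) ^ 2 ∣ M ^ 2 := ⟨(e ^ 2 + 8 * ε * y ^ 2) * (y ^ 2 + 2 * ε * e ^ 2), by
        rw [← h2]; ring⟩
      exact (Int.pow_dvd_pow_iff (by norm_num)).1 this
    have h3 : (e ^ 2 + 8 * ε * y ^ 2) * (y ^ 2 + 2 * ε * e ^ 2) = L ^ 2 := by linarith
    have h4 := congrArg (Int.cast : ℤ → ZMod 8) h3
    push_cast at h4
    exact dec2 _ _ _ _ ez fz h4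
  · have h4 := congrArg (Int.cast : ℤ → ZMod 8) h2
    push_cast at h4
    apply dec _ _ _ _ ez fz h4
    have : ((x ^ 2 : ℤ) : ZMod 8) = ((1 : ℤ) : ZMod 8) := (ZMod.intCast_eq_intCast_iff' _ _ 8).2 (by simpa using sq8 hxo)
    simpa using this

theorem classes (u W : ℚ) (h : W ^ 2 = u * (u + 1) * (u + 16)) (h0 : u ≠ 0) (h1 : u + 1 ≠ 0) :
    ∃ (d₁ d₂ : ℤ) (ρ τ θ : ℚ), (d₁ = 1 ∨ d₁ = -1) ∧
      (d₂ = 1 ∨ d₂ = -1 ∨ d₂ = 3 ∨ d₂ = -3 ∨ d₂ = 5 ∨ d₂ = -5 ∨ d₂ = 15 ∨ d₂ = -15) ∧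
      u = d₁ * ρ ^ 2 ∧ u + 1 = d₂ * τ ^ 2 ∧ u + 16 = d₁ * d₂ * θ ^ 2 := by
  have hu : u * u.den = u.num := Rat.mul_den_eq_num u
  have hcop : IsCoprime u.num (u.den : ℤ) := by
    rw [Int.isCoprime_iff_gcd_eq_one]; exact u.reduced
  have hD0 : (0 : ℤ) < u.den := by exact_mod_cast u.pos
  have hm0 : u.num ≠ 0 := by simpa using h0
  generalize hm : u.num = m at *
  have hDq : ((u.den : ℤ) : ℚ) = (u.den : ℚ) := by simp
  rw [← hDq] at hu
  generalize (u.den : ℤ) = D at *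
  have hcop1 : IsCoprime (m + D) D := by simpa using hcop.add_mul_left_left 1
  have hcop16 : IsCoprime (m + 16 * D) D := by
    have := hcop.add_mul_left_left 16
    rwa [mul_comm D 16] at this
  obtain ⟨K, hK⟩ := rat_sq_int (n := D * (m * (m + D) * (m + 16 * D))) (t := W * D ^ 2) (by
    push_cast; rw [← hu, mul_pow, h]; ring)
  obtain ⟨e, he⟩ : ∃ e : ℤ, D = e ^ 2 := by
    obtain ⟨e, he | he⟩ := Int.sq_of_isCoprime (((hcop.mul_left hcop1).mul_left hcop16).symm) hK
    · exact ⟨e, he⟩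
    · nlinarith [sq_nonneg e]
  subst he
  have he0 : e ≠ 0 := by rintro rfl; simp at hD0
  have heq : (e : ℚ) ≠ 0 := by exact_mod_cast he0
  push_cast at hu
  obtain ⟨N, hN⟩ := rat_sq_int (n := m * (m + e ^ 2) * (m + 16 * e ^ 2)) (t := W * e ^ 3) (by
    push_cast; rw [← hu, mul_pow, h]; ring)
  have hm1 : m + e ^ 2 ≠ 0 := by
    intro hh
    have : ((m + e ^ 2 : ℤ) : ℚ) = 0 := by rw [hh]; simp
    push_cast at this
    rw [← hu] at this
    have : (u + 1) * (e : ℚ) ^ 2 = 0 := by linarith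
    simp [h1, heq] at this
  obtain ⟨d₁, x, hx, hd₁⟩ := sqfree_decomp m
  obtain ⟨d₂, y, hy, hd₂⟩ := sqfree_decomp (m + e ^ 2)
  have hx0 : x ≠ 0 := by rintro rfl; simp at hx; exact hm0 hx
  have hy0 : y ≠ 0 := by rintro rfl; simp at hy; exact hm1 hy
  have hmm : IsCoprime m (m + e ^ 2) := by simpa [add_comm] using hcop.add_mul_left_right 1
  have k1 : d₁ ∣ (m + e ^ 2) * (m + 16 * e ^ 2) := sqfree_dvd (N := N) hd₁ hx0 (by rw [← hx, ← hN]; ring)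
  have k2 : d₂ ∣ m * (m + 16 * e ^ 2) := sqfree_dvd (N := N) hd₂ hy0 (by rw [← hy, ← hN]; ring)
  have q1 : d₁ ∣ m := ⟨x ^ 2, hx⟩
  have q2 : d₂ ∣ m + e ^ 2 := ⟨y ^ 2, hy⟩
  have k1 : d₁ ∣ m + 16 * e ^ 2 := (hmm.of_isCoprime_of_dvd_left q1).dvd_of_dvd_mul_left k1
  have k2 : d₂ ∣ m + 16 * e ^ 2 := (hmm.symm.of_isCoprime_of_dvd_left q2).dvd_of_dvd_mul_left k2
  have k1 : d₁ ∣ 16 * e ^ 2 := by simpa using dvd_sub k1 q1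
  have k2 : d₂ ∣ 15 * e ^ 2 := by
    have := dvd_sub k2 q2
    rwa [show m + 16 * e ^ 2 - (m + e ^ 2) = 15 * e ^ 2 by ring] at this
  have k1 : d₁ ∣ 16 := (hcop.of_isCoprime_of_dvd_left q1).dvd_of_dvd_mul_right k1
  have k2 : d₂ ∣ 15 := (hcop1.of_isCoprime_of_dvd_left q2).dvd_of_dvd_mul_right k2
  have k1 : d₁ ∣ 2 := hd₁.isRadical 4 2 (by norm_num; exact k1)
  have dd₁ : d₁ = 1 ∨ d₁ = -1 := by
    have b1 := Int.le_of_dvd (by norm_num) k1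
    have b2 := Int.le_of_dvd (by norm_num) ((neg_dvd).2 k1)
    have b3 : -2 ≤ d₁ := by omega
    have hodd : Even m → Odd e := by
      intro hev
      by_contra hh
      rw [Int.not_odd_iff_even] at hh
      have := hcop.isUnit_of_dvd' hev.two_dvd (hh.two_dvd.trans (dvd_pow_self e two_ne_zero))
      norm_num [Int.isUnit_iff] at this
    interval_cases d₁
    · exfalso
      have hm' : m = -1 * 2 * x ^ 2 := by linarith
      refine kill_two (-1) x e N (by simp) hx0 (hodd ⟨-x ^ 2, by linarith⟩) ?_
      rw [← hm', hN]
    · simp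
    · simp at hd₁
    · simp
    · exfalso
      have hm' : m = 1 * 2 * x ^ 2 := by linarith
      refine kill_two 1 x e N (by simp) hx0 (hodd ⟨x ^ 2, by linarith⟩) ?_
      rw [← hm', hN]
  have dd₂ : d₂ = 1 ∨ d₂ = -1 ∨ d₂ = 3 ∨ d₂ = -3 ∨ d₂ = 5 ∨ d₂ = -5 ∨ d₂ = 15 ∨ d₂ = -15 := by
    have b1 := Int.le_of_dvd (by norm_num) k2
    have b2 := Int.le_of_dvd (by norm_num) ((neg_dvd).2 k2)
    have b3 : -15 ≤ d₂ := by omega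
    obtain ⟨l, hl⟩ := k2
    interval_cases d₂ <;> omega
  have d₁q : (d₁ : ℚ) ≠ 0 := by exact_mod_cast hd₁.ne_zero
  have d₂q : (d₂ : ℚ) ≠ 0 := by exact_mod_cast hd₂.ne_zero
  have xq : (x : ℚ) ≠ 0 := by exact_mod_cast hx0
  have yq : (y : ℚ) ≠ 0 := by exact_mod_cast hy0
  have hxq : (m : ℚ) = d₁ * x ^ 2 := by exact_mod_cast hx
  have hyq : (m : ℚ) + e ^ 2 = d₂ * y ^ 2 := by exact_mod_cast hy
  have r1 : u = d₁ * (x / e) ^ 2 := by field_simp; linarith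
  have r2 : u + 1 = d₂ * (y / e) ^ 2 := by field_simp; linarith
  refine ⟨d₁, d₂, x / e, y / e, W / (d₁ * d₂ * (x / e) * (y / e)), dd₁, dd₂, r1, r2, ?_⟩
  have : u + 16 = W ^ 2 / (u * (u + 1)) := by rw [h]; field_simp
  rw [this, r2, r1]
  field_simp

theorem sq_div_clear {a b c k : ℚ} (hc : c ≠ 0) (h : a ^ 2 + k * c ^ 2 = b ^ 2) :
    (a / c) ^ 2 + k = (b / c) ^ 2 := by
  rw [div_pow, div_pow, ← h]; field_simp

theorem u_values (u W : ℚ) (h : W ^ 2 = u * (u + 1) * (u + 16)) :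
    u = 0 ∨ u = -1 ∨ u = -16 ∨ u = 4 ∨ u = -4 := by
  by_cases h0 : u = 0
  · exact Or.inl h0
  by_cases h1 : u + 1 = 0
  · exact Or.inr (Or.inl (by linarith))
  obtain ⟨d₁, d₂, ρ, τ, θ, hd₁, hd₂, e1, e2, e3⟩ := classes u W h h0 h1
  have hρ : ρ ≠ 0 := by rintro rfl; simp at e1; exact h0 e1
  have hτ : τ ≠ 0 := by rintro rfl; simp at e2; exact h1 e2
  have pρ : 0 < ρ ^ 2 := by positivity
  have pτ : 0 < τ ^ 2 := by positivity
  have pθ : 0 ≤ θ ^ 2 := by positivity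
  rcases hd₁ with rfl | rfl
  · rcases hd₂ with rfl | rfl | rfl | rfl | rfl | rfl | rfl | rfl <;> push_cast at e1 e2 e3
    · exact absurd (desc_rat ρ τ θ (by linarith) (by linarith)) hρ
    · exfalso; linarith
    · exact absurd (by push_cast; linarith) (no_sum_sq 3 (by simp) ρ 1 τ hτ)
    · exfalso; linarith
    · by_cases h4 : u - 4 = 0
      · right; right; right; left; linarith
      have r : ρ ^ 2 = u := by linarith
      have t : τ ^ 2 = (u + 1) / 5 := by linarith
      have w : θ ^ 2 = (u + 16) / 5 := by linarith
      have := desc_rat (10 * (ρ - τ * θ) / (u - 4)) ((20 * τ - 5 * ρ * θ) / (u - 4)) (10 * (θ - ρ * τ) / (u - 4))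
        (sq_div_clear h4 (by linear_combination 100 * r + 100 * θ ^ 2 * t + 20 * (u + 1) * w - 400 * t - 25 * θ ^ 2 * r - 25 * u * w))
        (sq_div_clear h4 (by linear_combination 100 * r + 100 * θ ^ 2 * t + 20 * (u + 1) * w - 100 * w - 100 * τ ^ 2 * r - 100 * u * t))
      have h5 : ρ - τ * θ = 0 := by simpa [h4] using this
      exfalso
      apply h4
      have h6 : ρ ^ 2 = τ ^ 2 * θ ^ 2 := by rw [sub_eq_zero.1 h5]; ring
      have : (u - 4) ^ 2 = 0 := by
        linear_combination -25 * (h6) - 25 * e1 + (u + 16) * e2 + 5 * τ ^ 2 * e3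
      exact pow_eq_zero_iff two_ne_zero |>.1 this
    · exfalso; linarith
    · exact absurd (by push_cast; linarith) (no_sum_sq 15 (by simp) ρ 1 τ hτ)
    · exfalso; linarith
  · rcases hd₂ with rfl | rfl | rfl | rfl | rfl | rfl | rfl | rfl <;> push_cast at e1 e2 e3
    · exfalso; linarith
    · exact absurd (by push_cast; linarith) (no_sum_sq 15 (by simp) (4 * τ) θ ρ hρ)
    · exfalso; linarith
    · by_cases h4 : u + 4 = 0
      · right; right; right; right; linarith
      have r : ρ ^ 2 = -u := by linarith
      have t : τ ^ 2 = -(u + 1) / 3 := by linarith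
      have w : θ ^ 2 = (u + 16) / 3 := by linarith
      have := desc_rat (6 * (ρ - τ * θ) / (u + 4)) ((12 * τ - 3 * ρ * θ) / (u + 4)) (6 * (θ - ρ * τ) / (u + 4))
        (sq_div_clear h4 (by linear_combination 36 * r + 36 * θ ^ 2 * t - 12 * (u + 1) * w - 144 * t - 9 * θ ^ 2 * r + 9 * u * w))
        (sq_div_clear h4 (by linear_combination 36 * r + 36 * θ ^ 2 * t - 12 * (u + 1) * w - 36 * w - 36 * τ ^ 2 * r + 36 * u * t))
      have h5 : ρ - τ * θ = 0 := by simpa [h4] using this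
      exfalso
      apply h4
      have h6 : ρ ^ 2 = τ ^ 2 * θ ^ 2 := by rw [sub_eq_zero.1 h5]; ring
      have : (u + 4) ^ 2 = 0 := by
        linear_combination 9 * (h6) - 9 * e1 + (u + 16) * e2 - 3 * τ ^ 2 * e3
      exact pow_eq_zero_iff two_ne_zero |>.1 this
    · exfalso; linarith
    · exact absurd (by push_cast; linarith) (no_sum_sq 3 (by simp) τ θ 1 one_ne_zero)
    · exfalso; linarith
    · have := desc_rat (θ / τ) (1 / τ) (ρ / τ) (by field_simp; linarith) (by field_simp; linarith)
      have hθ : θ = 0 := by simpa [hτ] using this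
      right; right; left
      rw [hθ] at e3; linarith

theorem E₂_ns_iff (x y : ℚ) : E₂.Nonsingular x y ↔
    (y ^ 2 + x * y + y = x ^ 3 + x ^ 2 - 5 * x + 2 ∧
      (y ≠ 3 * x ^ 2 + 2 * x - 5 ∨ y ≠ -y - x - 1)) := by
  rw [WeierstrassCurve.Affine.nonsingular_iff, WeierstrassCurve.Affine.equation_iff]
  simp [E₂, sub_eq_add_neg]

theorem E₂_add {x₁ y₁ x₂ y₂ x₃ y₃ : ℚ} (l : ℚ) (h₁ : E₂.Nonsingular x₁ y₁) (h₂ : E₂.Nonsingular x₂ y₂)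
    (h₃ : E₂.Nonsingular x₃ y₃) (hxy : x₁ ≠ x₂) (hl : (y₁ - y₂) / (x₁ - x₂) = l)
    (hx : l ^ 2 + l - 1 - x₁ - x₂ = x₃) (hy : -(l * (x₃ - x₁) + y₁) - x₃ - 1 = y₃) :
    WeierstrassCurve.Affine.Point.some x₁ y₁ h₁ + .some x₂ y₂ h₂ = .some x₃ y₃ h₃ := by
  rw [WeierstrassCurve.Affine.Point.add_of_X_ne hxy]
  have hs : E₂.slope x₁ x₂ y₁ y₂ = l := by
    rw [WeierstrassCurve.Affine.slope_of_X_ne hxy, hl]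
  have hX : E₂.addX x₁ x₂ l = x₃ := by
    rw [← hx]; simp [WeierstrassCurve.Affine.addX, E₂]
  simp only [WeierstrassCurve.Affine.Point.some.injEq, hs, hX, true_and]
  rw [WeierstrassCurve.Affine.addY, WeierstrassCurve.Affine.negAddY, hX, ← hy]
  simp [WeierstrassCurve.Affine.negY, E₂]

theorem E₂_neg {x₁ y₁ x₂ y₂ : ℚ} (h₁ : E₂.Nonsingular x₁ y₁) (h₂ : E₂.Nonsingular x₂ y₂)
    (hx : x₁ = x₂) (hy : y₁ + y₂ + x₂ + 1 = 0) :
    WeierstrassCurve.Affine.Point.some x₁ y₁ h₁ + .some x₂ y₂ h₂ = 0 := by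
  apply WeierstrassCurve.Affine.Point.add_of_Y_eq hx
  simp [WeierstrassCurve.Affine.negY, E₂]
  linarith

theorem nsP : E₂.Nonsingular 2 1 := by rw [E₂_ns_iff]; norm_num
theorem nsP2 : E₂.Nonsingular 1 (-1) := by rw [E₂_ns_iff]; norm_num
theorem nsP3 : E₂.Nonsingular 2 (-4) := by rw [E₂_ns_iff]; norm_num
theorem nsQ : E₂.Nonsingular (-3) 1 := by rw [E₂_ns_iff]; norm_num
theorem nsQ2 : E₂.Nonsingular (3/4) (-7/8) := by rw [E₂_ns_iff]; norm_num
theorem nsR : E₂.Nonsingular 0 1 := by rw [E₂_ns_iff]; norm_num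
theorem nsR3 : E₂.Nonsingular 0 (-2) := by rw [E₂_ns_iff]; norm_num

open WeierstrassCurve.Affine in
theorem E₂_points (A : E₂.Point) : A = 0 ∨ A = .some _ _ nsP ∨ A = .some _ _ nsP2 ∨ A = .some _ _ nsP3 ∨
    A = .some _ _ nsQ ∨ A = .some _ _ nsQ2 ∨ A = .some _ _ nsR ∨ A = .some _ _ nsR3 := by
  rcases A with _ | ⟨x, y, h⟩
  · left; rfl
  · have he := ((E₂_ns_iff x y).1 h).1
    simp only [Point.some.injEq]
    right
    have hu := u_values (4 * x - 4) (4 * (2 * y + x + 1)) (by linear_combination 64 * he)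
    rcases hu with hu | hu | hu | hu | hu
    · obtain rfl : x = 1 := by linarith
      have : (y + 1) ^ 2 = 0 := by linear_combination he
      have := pow_eq_zero_iff two_ne_zero |>.1 this
      obtain rfl : y = -1 := by linarith
      simp
    · obtain rfl : x = 3 / 4 := by linarith
      have : (y + 7 / 8) ^ 2 = 0 := by linear_combination he
      have := pow_eq_zero_iff two_ne_zero |>.1 this
      obtain rfl : y = -7 / 8 := by linarith
      simp
    · obtain rfl : x = -3 := by linarith
      have : (y - 1) ^ 2 = 0 := by linear_combination he
      have := pow_eq_zero_iff two_ne_zero |>.1 this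
      obtain rfl : y = 1 := by linarith
      simp
    · obtain rfl : x = 2 := by linarith
      have : (y - 1) * (y + 4) = 0 := by linear_combination he
      rcases mul_eq_zero.1 this with h | h
      · obtain rfl : y = 1 := by linarith
        simp
      · obtain rfl : y = -4 := by linarith
        simp
    · obtain rfl : x = 0 := by linarith
      have : (y - 1) * (y + 2) = 0 := by linear_combination he
      rcases mul_eq_zero.1 this with h | h
      · obtain rfl : y = 1 := by linarith
        simp
      · obtain rfl : y = -2 := by linarith
        simp

open WeierstrassCurve.Affine in
theorem addPP : Point.some _ _ nsP + .some _ _ nsP = .some _ _ nsP2 := by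
  have hn : (1 : ℚ) ≠ E₂.negY 2 1 := by norm_num [negY, E₂]
  rw [Point.add_self_of_Y_ne hn]
  simp only [Point.some.injEq, addY, negAddY, slope_of_Y_ne rfl hn]
  norm_num [negY, addX, E₂]

/-- The group of rational points of `E₂ : y² + xy + y = x³ + x² − 5x + 2` over `ℚ`
(Cremona label 15A3) is isomorphic to `ℤ/2ℤ ⊕ ℤ/4ℤ`. -/
theorem E₂_rational_points_iso :
    Nonempty (E₂.Point ≃+ (ZMod 2 × ZMod 4)) := by
  set P : E₂.Point := .some _ _ nsP with hP
  set P2 : E₂.Point := .some _ _ nsP2 with hP2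
  set P3 : E₂.Point := .some _ _ nsP3 with hP3
  set Q : E₂.Point := .some _ _ nsQ with hQ
  set Q2 : E₂.Point := .some _ _ nsQ2 with hQ2
  set R : E₂.Point := .some _ _ nsR with hR
  set R3 : E₂.Point := .some _ _ nsR3 with hR3
  have a1 : P + P = P2 := addPP
  have a2 : P2 + P = P3 := E₂_add 2 _ _ _ (by norm_num) (by norm_num) (by norm_num) (by norm_num)
  have a3 : P3 + P = 0 := E₂_neg _ _ rfl (by norm_num)
  have b0 : Q + Q = 0 := E₂_neg _ _ rfl (by norm_num)
  have b1 : Q + P = R3 := E₂_add 0 _ _ _ (by norm_num) (by norm_num) (by norm_num) (by norm_num)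
  have b2 : Q + P2 = Q2 := E₂_add (-1/2) _ _ _ (by norm_num) (by norm_num) (by norm_num) (by norm_num)
  have b3 : Q + P3 = R := E₂_add (-1) _ _ _ (by norm_num) (by norm_num) (by norm_num) (by norm_num)
  have s2 : 2 • P = P2 := by rw [two_nsmul, a1]
  have s3 : 3 • P = P3 := by rw [succ_nsmul, s2, a2]
  have s4 : 4 • P = 0 := by rw [succ_nsmul, s3, a3]
  have z4 : zmultiplesHom E₂.Point P ((4 : ℕ) : ℤ) = 0 := by
    rw [zmultiplesHom_apply, natCast_zsmul, s4]
  have z2 : zmultiplesHom E₂.Point Q ((2 : ℕ) : ℤ) = 0 := by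
    rw [zmultiplesHom_apply, natCast_zsmul, two_nsmul, b0]
  let f4 : ZMod 4 →+ E₂.Point := ZMod.lift 4 ⟨zmultiplesHom _ P, by
    exact z4⟩
  let f2 : ZMod 2 →+ E₂.Point := ZMod.lift 2 ⟨zmultiplesHom _ Q, by
    exact z2⟩
  have f4n : ∀ n : ℕ, f4 (n : ZMod 4) = n • P := by
    intro n
    have := ZMod.lift_coe 4 ⟨zmultiplesHom _ P, z4⟩ (n : ℤ)
    simpa [f4] using this
  have f41 : f4 1 = P := by simpa using f4n 1
  have f42 : f4 2 = P2 := by rw [← s2]; exact f4n 2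
  have f43 : f4 3 = P3 := by rw [← s3]; exact f4n 3
  have f21 : f2 1 = Q := by
    have := ZMod.lift_coe 2 ⟨zmultiplesHom _ Q, z2⟩ (1 : ℤ)
    simpa [f2] using this
  let f : ZMod 2 × ZMod 4 →+ E₂.Point := f2.coprod f4
  have hf : ∀ i j, f (i, j) = f2 i + f4 j := fun i j => by simp [f]
  refine ⟨(AddEquiv.ofBijective f ⟨?_, ?_⟩).symm⟩
  · rw [injective_iff_map_eq_zero]
    rintro ⟨i, j⟩ hij
    rw [hf] at hij
    have hi : i = 0 ∨ i = 1 := by clear hij; revert i; decide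
    have hj : j = 0 ∨ j = 1 ∨ j = 2 ∨ j = 3 := by clear hij; revert j; decide
    have nz : ∀ {x y : ℚ} (h : E₂.Nonsingular x y), WeierstrassCurve.Affine.Point.some x y h ≠ 0 :=
      fun h => WeierstrassCurve.Affine.Point.some_ne_zero h
    rcases hi with rfl | rfl <;> rcases hj with rfl | rfl | rfl | rfl <;>
      simp only [map_zero, f41, f42, f43, f21, zero_add, add_zero, b1, b2, b3] at hij
    · rfl
    all_goals exact absurd hij (nz _)
  · intro A
    rcases E₂_points A with h | h | h | h | h | h | h | h
    · exact ⟨(0, 0), by rw [hf, h]; simp⟩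
    · exact ⟨(0, 1), by rw [hf, h, f41]; simp [hP]⟩
    · exact ⟨(0, 2), by rw [hf, h, f42]; simp [hP2]⟩
    · exact ⟨(0, 3), by rw [hf, h, f43]; simp [hP3]⟩
    · exact ⟨(1, 0), by rw [hf, h, f21]; simp [hQ]⟩
    · exact ⟨(1, 2), by rw [hf, h, f21, f42, b2]⟩
    · exact ⟨(1, 3), by rw [hf, h, f21, f43, b3]⟩
    · exact ⟨(1, 1), by rw [hf, h, f21, f41, b1]⟩
end
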